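/- arXiv:1505.00080 — 5 statements merged into one kernel-verified Lean document; each statement's English description precedes it below -/
import Mathlib

section
/- Let M_R ≥ 1 and M_T ≥ 2 be integers, let d₁^τ > 0, d₂^τ > 0, ρ₁ > 0, η > 0, α ∈ (0,1) be reals, set κ = ηα/(1−α), and let X and W be independent real random variables with X ~ Gamma(M_R, 1) and W ~ Gamma(M_T−1, 1). Define the random variable γ_TZF = (ρ₁/((1−α) d₁^τ)) · X · min(1−α, (ηα/d₂^τ) W). Then for every z > 0, ℙ(γ_TZF < z) = 1 − (1/Γ(M_R)) ∫_{d₁^τ z/ρ₁}^{∞} Q(M_T−1, d₁^τ d₂^τ z/(κ ρ₁ x)) x^{M_R−1} e^{−x} dx. -/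
open MeasureTheory ProbabilityTheory Real

/-- The regularized upper incomplete Gamma function `Q(a,x) = Γ(a,x)/Γ(a)`,
where `Γ(a,x) = ∫_x^∞ t^(a−1) e^(−t) dt`. -/
noncomputable def regGammaQ (a x : ℝ) : ℝ :=
  (∫ t in Set.Ioi x, t ^ (a - 1) * Real.exp (-t)) / Real.Gamma a

lemma gammaMeasure_one_Ici {a y : ℝ} (ha : 0 < a) (hy : 0 ≤ y) :
    gammaMeasure a 1 (Set.Ici y) = ENNReal.ofReal (regGammaQ a y) := by
  have hint : IntegrableOn (fun t : ℝ => t ^ (a - 1) * Real.exp (-t)) (Set.Ioi y) := by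
    exact ((Real.GammaIntegral_convergent ha).mono_set (Set.Ioi_subset_Ioi hy)).congr_fun
      (fun t _ => mul_comm _ _) measurableSet_Ioi
  rw [gammaMeasure, withDensity_apply _ measurableSet_Ici,
    setLIntegral_congr Ioi_ae_eq_Ici.symm, regGammaQ, ← integral_div,
    ofReal_integral_eq_lintegral_ofReal (hint.div_const _)]
  · refine setLIntegral_congr_fun measurableSet_Ioi fun t ht => ?_
    have ht : y < t := ht
    rw [gammaPDF_of_nonneg (hy.trans ht.le), Real.one_rpow, one_mul]
    congr 1
    ring
  · refine (ae_restrict_iff' measurableSet_Ioi).2 (ae_of_all _ fun t ht => ?_)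
    have ht : 0 < t := hy.trans_lt ht
    have := Real.Gamma_pos_of_pos ha
    simp only [Pi.zero_apply]
    positivity

lemma regGammaQ_nonneg {a y : ℝ} (ha : 0 < a) (hy : 0 ≤ y) : 0 ≤ regGammaQ a y := by
  refine div_nonneg (setIntegral_nonneg measurableSet_Ioi fun t ht => ?_)
    (Real.Gamma_pos_of_pos ha).le
  have ht : 0 < t := hy.trans_lt ht
  positivity

lemma le_snr_iff {d1 d2 ρ1 η α z x w : ℝ} (hd1 : 0 < d1) (hd2 : 0 < d2) (hρ1 : 0 < ρ1)
    (hη : 0 < η) (hα0 : 0 < α) (hα1 : α < 1) (hx : 0 < x) :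
    z ≤ ρ1 / ((1 - α) * d1) * x * min (1 - α) (η * α / d2 * w) ↔
      d1 * z / ρ1 ≤ x ∧ d1 * d2 * z / (η * α / (1 - α) * ρ1 * x) ≤ w := by
  have hα : 0 < 1 - α := sub_pos.2 hα1
  rw [mul_min_of_nonneg _ _ (by positivity), le_min_iff]
  refine and_congr ?_ ?_
  · rw [div_le_iff₀ hρ1, show ρ1 / ((1 - α) * d1) * x * (1 - α) = x * ρ1 / d1 by field_simp,
      le_div_iff₀ hd1, mul_comm z]
  · rw [div_le_iff₀ (by positivity),
      show ρ1 / ((1 - α) * d1) * x * (η * α / d2 * w)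
        = w * (η * α / (1 - α) * ρ1 * x) / (d1 * d2) by field_simp,
      le_div_iff₀ (by positivity), mul_comm z]

/-- Outage probability of the TZF scheme (Eq. (14)): if `X ~ Gamma(M_R,1)` and
`W ~ Gamma(M_T−1,1)` are independent, and
`γ_TZF = (ρ₁/((1−α)d₁^τ)) X min(1−α, (ηα/d₂^τ) W)`, then for `z > 0`,
`ℙ(γ_TZF < z) = 1 − (1/Γ(M_R)) ∫_{d₁^τ z/ρ₁}^∞ Q(M_T−1, d₁^τ d₂^τ z/(κ ρ₁ x)) x^(M_R−1) e^(−x) dx`. -/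
theorem outage_TZF {Ω : Type*} {mΩ : MeasurableSpace Ω}
    (μ : Measure Ω) [IsProbabilityMeasure μ]
    (MR MT : ℕ) (hMR : 1 ≤ MR) (hMT : 2 ≤ MT)
    (d1 d2 ρ1 η α : ℝ) (hd1 : 0 < d1) (hd2 : 0 < d2) (hρ1 : 0 < ρ1)
    (hη : 0 < η) (hα0 : 0 < α) (hα1 : α < 1)
    (κ : ℝ) (hκ : κ = η * α / (1 - α))
    (X W : Ω → ℝ) (hX : Measurable X) (hW : Measurable W)
    (hXlaw : μ.map X = gammaMeasure (MR : ℝ) 1)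
    (hWlaw : μ.map W = gammaMeasure ((MT : ℝ) - 1) 1)
    (hindep : IndepFun X W μ)
    (z : ℝ) (hz : 0 < z) :
    μ {ω | ρ1 / ((1 - α) * d1) * X ω * min (1 - α) (η * α / d2 * W ω) < z}
      = ENNReal.ofReal (1 - (1 / Real.Gamma (MR : ℝ)) *
          ∫ x in Set.Ioi (d1 * z / ρ1),
            regGammaQ ((MT : ℝ) - 1) (d1 * d2 * z / (κ * ρ1 * x))
              * x ^ ((MR : ℝ) - 1) * Real.exp (-x)) := by
  have hα : 0 < 1 - α := sub_pos.2 hα1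
  have hκ0 : 0 < κ := by rw [hκ]; positivity
  have ha : (0 : ℝ) < MR := by exact_mod_cast hMR
  have hb : (0 : ℝ) < (MT : ℝ) - 1 := by
    have : (2 : ℝ) ≤ MT := by exact_mod_cast hMT
    linarith
  have := isProbabilityMeasure_gammaMeasure ha one_pos
  have := isProbabilityMeasure_gammaMeasure hb one_pos
  set S : Set (ℝ × ℝ) :=
    {p | z ≤ ρ1 / ((1 - α) * d1) * p.1 * min (1 - α) (η * α / d2 * p.2)} with hS
  have hSm : MeasurableSet S := measurableSet_le measurable_const (by fun_prop)
  have hlaw : μ.map (fun ω => (X ω, W ω))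
      = (gammaMeasure (MR : ℝ) 1).prod (gammaMeasure ((MT : ℝ) - 1) 1) := by
    rw [(indepFun_iff_map_prod_eq_prod_map_map hX.aemeasurable hW.aemeasurable).1 hindep,
      hXlaw, hWlaw]
  set F : ℝ → ENNReal := fun x =>
    gammaPDF (MR : ℝ) 1 x * gammaMeasure ((MT : ℝ) - 1) 1 (Prod.mk x ⁻¹' S) with hF
  have hpdf : Measurable (gammaPDF (MR : ℝ) 1) := (measurable_gammaPDFReal _ _).ennreal_ofReal
  have hsec : Measurable fun x => gammaMeasure ((MT : ℝ) - 1) 1 (Prod.mk x ⁻¹' S) :=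
    measurable_measure_prodMk_left hSm
  have hFm : Measurable F := hpdf.mul hsec
  have hx0 : 0 < d1 * z / ρ1 := by positivity
  have hprod : (gammaMeasure (MR : ℝ) 1).prod (gammaMeasure ((MT : ℝ) - 1) 1) S
      = ∫⁻ x in Set.Ioi (d1 * z / ρ1), F x := by
    rw [Measure.prod_apply hSm]
    conv_lhs => rw [gammaMeasure]
    rw [lintegral_withDensity_eq_lintegral_mul _ hpdf hsec,
      setLIntegral_congr Ioi_ae_eq_Ici, ← lintegral_indicator measurableSet_Ici]
    refine lintegral_congr_ae ?_
    filter_upwards [Measure.ae_ne volume (0 : ℝ)] with x hx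
    by_cases hxi : x ∈ Set.Ici (d1 * z / ρ1)
    · rw [Set.indicator_of_mem hxi, Pi.mul_apply]
    · rw [Set.indicator_of_notMem hxi, Pi.mul_apply]
      rcases lt_or_gt_of_ne hx with hx | hx
      · rw [gammaPDF_of_neg hx, zero_mul]
      · have : Prod.mk x ⁻¹' S = ∅ := by
          refine Set.eq_empty_of_forall_notMem fun w hw => hxi ?_
          exact ((le_snr_iff hd1 hd2 hρ1 hη hα0 hα1 hx).1 hw).1
        rw [this, measure_empty, mul_zero]
  have hint : (1 / Real.Gamma (MR : ℝ)) * ∫ x in Set.Ioi (d1 * z / ρ1),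
      regGammaQ ((MT : ℝ) - 1) (d1 * d2 * z / (κ * ρ1 * x)) * x ^ ((MR : ℝ) - 1) * Real.exp (-x)
      = (∫⁻ x in Set.Ioi (d1 * z / ρ1), F x).toReal := by
    rw [← integral_const_mul, ← integral_toReal hFm.aemeasurable]
    · refine setIntegral_congr_fun measurableSet_Ioi fun x hx => ?_
      have hx : d1 * z / ρ1 < x := hx
      have hxpos : 0 < x := hx0.trans hx
      have hset : Prod.mk x ⁻¹' S = Set.Ici (d1 * d2 * z / (κ * ρ1 * x)) := by
        ext w
        rw [hκ]
        exact (le_snr_iff hd1 hd2 hρ1 hη hα0 hα1 hxpos).trans (and_iff_right hx.le)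
      have hy : 0 ≤ d1 * d2 * z / (κ * ρ1 * x) := by positivity
      simp only [hF]
      rw [hset, gammaMeasure_one_Ici hb hy, ENNReal.toReal_mul,
        ENNReal.toReal_ofReal (regGammaQ_nonneg hb hy), gammaPDF,
        ENNReal.toReal_ofReal (gammaPDFReal_nonneg ha one_pos x), gammaPDFReal,
        if_pos hxpos.le, Real.one_rpow, one_mul]
      ring
    · exact ae_of_all _ fun x => ENNReal.mul_lt_top ENNReal.ofReal_lt_top (measure_lt_top _ _)
  have hevent : {ω | ρ1 / ((1 - α) * d1) * X ω * min (1 - α) (η * α / d2 * W ω) < z}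
      = (fun ω => (X ω, W ω)) ⁻¹' Sᶜ := by
    ext ω
    simp [hS]
  rw [hint, hevent, ← Measure.map_apply (hX.prodMk hW) hSm.compl, hlaw, prob_compl_eq_one_sub hSm,
    ← hprod, ENNReal.ofReal_sub _ ENNReal.toReal_nonneg, ENNReal.ofReal_one,
    ENNReal.ofReal_toReal (measure_ne_top _ _)]
end

section
/- Let M_R ≥ 1 and M_T ≥ 1 be integers, let d₁^τ > 0, d₂^τ > 0, ρ₁ > 0, η > 0, α ∈ (0,1) be reals, set κ = ηα/(1−α), and let X and W be independent real random variables with X ~ Gamma(M_R, 1) and W ~ Gamma(M_T, 1). Define the half-duplex end-to-end SNR γ_HD = X · min( ρ₁/d₁^τ, (2 κ ρ₁/(d₁^τ d₂^τ)) W ). Then for every z > 0, ℙ(γ_HD < z) = 1 − (1/Γ(M_R)) ∫_{d₁^τ z/ρ₁}^{∞} Q(M_T, d₁^τ d₂^τ z/(2 κ ρ₁ x)) x^{M_R−1} e^{−x} dx. -/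
open MeasureTheory ProbabilityTheory Real

namespace ProbabilityTheory

lemma measurable_gammaPDF (a r : ℝ) : Measurable (gammaPDF a r) :=
  (measurable_gammaPDFReal a r).ennreal_ofReal

lemma toReal_gammaPDF_one_of_nonneg {a x : ℝ} (ha : 0 < a) (hx : 0 ≤ x) :
    (gammaPDF a 1 x).toReal = 1 / Real.Gamma a * (x ^ (a - 1) * Real.exp (-x)) := by
  have := Real.Gamma_pos_of_pos ha
  rw [gammaPDF_of_nonneg hx, ENNReal.toReal_ofReal (by positivity)]
  simp [mul_assoc]

/-- The upper tail of the Gamma distribution of rate one is the regularized upper incomplete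
Gamma function. -/
lemma gammaMeasure_real_Ici {a y : ℝ} (ha : 0 < a) (hy : 0 ≤ y) :
    (gammaMeasure a 1).real (Set.Ici y) = regGammaQ a y := by
  have h : (gammaMeasure a 1).real (Set.Ici y) =
      ∫ x in Set.Ici y, (gammaPDF a 1 x).toReal • (1 : ℝ) := by
    rw [← setIntegral_withDensity_eq_setIntegral_toReal_smul (measurable_gammaPDF a 1)
      (ae_of_all _ fun x => by simp [gammaPDF]) _ measurableSet_Ici]
    simp [gammaMeasure]
  rw [h, setIntegral_congr_fun (g := fun x => 1 / Real.Gamma a * (x ^ (a - 1) * Real.exp (-x)))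
    measurableSet_Ici fun x hx => by
      simp [toReal_gammaPDF_one_of_nonneg ha (hy.trans hx)],
    integral_const_mul, integral_Ici_eq_integral_Ioi, regGammaQ]
  ring

/-- Expectations under the Gamma distribution of rate one of functions supported on
`[b, ∞)` up to the negligible negative half-line. -/
lemma integral_gammaMeasure_one_of_eq_zero {a b : ℝ} (ha : 0 < a) (hb : 0 ≤ b) {g : ℝ → ℝ}
    (hg : ∀ x, 0 ≤ x → x < b → g x = 0) :
    ∫ x, g x ∂gammaMeasure a 1 =
      1 / Real.Gamma a * ∫ x in Set.Ioi b, g x * x ^ (a - 1) * Real.exp (-x) := by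
  rw [gammaMeasure, integral_withDensity_eq_integral_toReal_smul (measurable_gammaPDF a 1)
    (ae_of_all _ fun x => by simp [gammaPDF]), ← integral_Ici_eq_integral_Ioi,
    ← integral_const_mul, ← integral_indicator measurableSet_Ici]
  congr 1 with x
  by_cases hx : b ≤ x
  · rw [Set.indicator_of_mem (Set.mem_Ici.2 hx), toReal_gammaPDF_one_of_nonneg ha (hb.trans hx),
      smul_eq_mul]
    ring
  · rw [Set.indicator_of_notMem (by simpa using hx)]
    rcases lt_or_ge x 0 with h0 | h0
    · simp [gammaPDF_of_neg h0]
    · simp [hg x h0 (not_le.1 hx)]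

end ProbabilityTheory

lemma MeasureTheory.Measure.real_prod_apply {β γ : Type*} [MeasurableSpace β]
    [MeasurableSpace γ] (μ : Measure β) (ν : Measure γ) [IsFiniteMeasure ν]
    {s : Set (β × γ)} (hs : MeasurableSet s) :
    (μ.prod ν).real s = ∫ x, ν.real (Prod.mk x ⁻¹' s) ∂μ := by
  simp only [measureReal_def]
  rw [integral_toReal (measurable_measure_prodMk_left hs).aemeasurable
    (ae_of_all _ fun _ => measure_lt_top _ _), prod_apply hs]

/-- Outage probability of the half-duplex benchmark (Eq. (24)): with independent
`X ~ Gamma(M_R,1)`, `W ~ Gamma(M_T,1)` and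
`γ_HD = X min(ρ₁/d₁^τ, (2κρ₁/(d₁^τ d₂^τ)) W)`, for every `z > 0`,
`ℙ(γ_HD < z) = 1 − (1/Γ(M_R)) ∫_{d₁^τ z/ρ₁}^∞ Q(M_T, d₁^τ d₂^τ z/(2κρ₁ x)) x^{M_R−1} e^{−x} dx`. -/
theorem outage_HD {Ω : Type*} {mΩ : MeasurableSpace Ω}
    (μ : Measure Ω) [IsProbabilityMeasure μ]
    (MR MT : ℕ) (hMR : 1 ≤ MR) (hMT : 1 ≤ MT)
    (d1 d2 ρ1 η α : ℝ) (hd1 : 0 < d1) (hd2 : 0 < d2) (hρ1 : 0 < ρ1)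
    (hη : 0 < η) (hα0 : 0 < α) (hα1 : α < 1)
    (κ : ℝ) (hκ : κ = η * α / (1 - α))
    (X W : Ω → ℝ) (hX : Measurable X) (hW : Measurable W)
    (hXlaw : μ.map X = gammaMeasure (MR : ℝ) 1)
    (hWlaw : μ.map W = gammaMeasure (MT : ℝ) 1)
    (hindep : IndepFun X W μ)
    (z : ℝ) (hz : 0 < z) :
    μ {ω | X ω * min (ρ1 / d1) (2 * κ * ρ1 / (d1 * d2) * W ω) < z}
      = ENNReal.ofReal (1 - (1 / Real.Gamma (MR : ℝ)) *
          ∫ x in Set.Ioi (d1 * z / ρ1),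
            regGammaQ (MT : ℝ) (d1 * d2 * z / (2 * κ * ρ1 * x))
              * x ^ ((MR : ℝ) - 1) * Real.exp (-x)) := by
  have hMR' : (0 : ℝ) < MR := by exact_mod_cast hMR
  have hMT' : (0 : ℝ) < MT := by exact_mod_cast hMT
  have hκ0 : 0 < κ := hκ ▸ div_pos (mul_pos hη hα0) (sub_pos.2 hα1)
  have := isProbabilityMeasure_gammaMeasure hMT' one_pos
  set S : Set (ℝ × ℝ) :=
    {p | z ≤ p.1 * min (ρ1 / d1) (2 * κ * ρ1 / (d1 * d2) * p.2)} with hS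
  have hSm : MeasurableSet S := measurableSet_le measurable_const (by fun_prop)
  have hXW : Measurable fun ω => (X ω, W ω) := hX.prodMk hW
  have hevent : {ω | X ω * min (ρ1 / d1) (2 * κ * ρ1 / (d1 * d2) * W ω) < z} =
      ((fun ω => (X ω, W ω)) ⁻¹' S)ᶜ := by
    ext ω
    simp [hS]
  have hslice : ∀ x, d1 * z / ρ1 ≤ x →
      Prod.mk x ⁻¹' S = Set.Ici (d1 * d2 * z / (2 * κ * ρ1 * x)) := by
    intro x hx
    have hx0 : 0 < x := lt_of_lt_of_le (by positivity) hx
    have h1 : z ≤ x * (ρ1 / d1) := by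
      rw [div_le_iff₀ hρ1] at hx
      rw [← mul_div_assoc, le_div_iff₀ hd1]
      linarith
    ext w
    simp only [hS, Set.mem_preimage, Set.mem_ofPred_eq, Set.mem_Ici]
    rw [mul_min_of_nonneg _ _ hx0.le, le_min_iff, and_iff_right h1, div_le_iff₀ (by positivity),
      show x * (2 * κ * ρ1 / (d1 * d2) * w) = w * (2 * κ * ρ1 * x) / (d1 * d2) by ring,
      le_div_iff₀ (by positivity), mul_comm z]
  have hempty : ∀ x, 0 ≤ x → x < d1 * z / ρ1 → Prod.mk x ⁻¹' S = ∅ := by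
    intro x hx0 hx
    refine Set.eq_empty_of_forall_notMem fun w hw => ?_
    have hw' : z ≤ x * (ρ1 / d1) :=
      le_trans hw (mul_le_mul_of_nonneg_left (min_le_left _ _) hx0)
    rw [lt_div_iff₀ hρ1] at hx
    rw [← mul_div_assoc, le_div_iff₀ hd1] at hw'
    linarith
  rw [hevent, ← ofReal_measureReal, probReal_compl_eq_one_sub (hXW hSm),
    ← map_measureReal_apply hXW hSm, hindep.map_prod_eq_prod_map_map hX.aemeasurable
    hW.aemeasurable, hXlaw, hWlaw, Measure.real_prod_apply _ _ hSm,
    integral_gammaMeasure_one_of_eq_zero (b := d1 * z / ρ1) hMR' (by positivity) fun x hx0 hx => by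
      rw [hempty x hx0 hx, measureReal_empty]]
  congr 3
  refine setIntegral_congr_fun measurableSet_Ioi fun x hx => ?_
  have hx0 : 0 < x := lt_trans (by positivity) hx
  simp only [hslice x (le_of_lt hx)]
  rw [gammaMeasure_real_Ici hMT' (by positivity)]
end

section
/- (Proposition 1, case M_T = M_R + 1.) Let M_R ≥ 1 be an integer and set M_T = M_R + 1, let d₁^τ > 0, d₂^τ > 0, η > 0, α ∈ (0,1) be reals, set κ = ηα/(1−α), and fix z > 0. For ρ > 0 let X, W be independent with X ~ Gamma(M_R, 1), W ~ Gamma(M_T−1, 1), and let F(ρ) = ℙ( (ρ/((1−α) d₁^τ)) X min(1−α, (ηα/d₂^τ) W) < z ) be the outage probability of the TZF scheme at first-hop SNR ρ. Then lim_{ρ→∞} ρ^{M_R} F(ρ)/ln ρ = (d₁^τ z)^{M_R} (d₂^τ/κ)^{M_R} / (Γ(M_R+1) Γ(M_R)). -/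
open MeasureTheory ProbabilityTheory Real Filter

/-- The Gamma law with integer shape `n + 1` and unit rate, as a density on `(0, ∞)`. -/
lemma gammaMeasure_natCast_add_one (n : ℕ) :
    gammaMeasure ((n : ℝ) + 1) 1 = (volume.restrict (Set.Ioi 0)).withDensity
      (fun x => ENNReal.ofReal (x ^ n * exp (-x) / n.factorial)) := by
  rw [gammaMeasure, ← withDensity_indicator measurableSet_Ioi]
  refine withDensity_congr_ae ?_
  have h0 : ∀ᵐ x : ℝ, x ≠ 0 := by simp [ae_iff]
  filter_upwards [h0] with x hx
  rcases lt_or_gt_of_ne hx with h | h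
  · rw [gammaPDF_of_neg h, Set.indicator_of_notMem (by simpa using h.le)]
  · rw [gammaPDF_of_nonneg h.le, Set.indicator_of_mem (by simpa using h)]
    congr 1
    rw [Real.Gamma_nat_eq_factorial]
    simp
    ring

lemma measurable_gammaDensity (n : ℕ) :
    Measurable (fun x : ℝ => ENNReal.ofReal (x ^ n * exp (-x) / n.factorial)) := by
  fun_prop

lemma gammaDensity_le {n : ℕ} {x : ℝ} (hx : 0 < x) :
    x ^ n * exp (-x) / n.factorial ≤ x ^ n / n.factorial := by
  gcongr
  exact mul_le_of_le_one_right (by positivity) (exp_le_one_iff.2 (by linarith))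

lemma lintegral_Ioc_const_mul_pow (n : ℕ) {c s : ℝ} (hc : 0 ≤ c) (hs : 0 ≤ s) :
    ∫⁻ x in Set.Ioc 0 s, ENNReal.ofReal (c * (x ^ n / n.factorial)) =
      ENNReal.ofReal (c * (s ^ (n + 1) / (n + 1).factorial)) := by
  rw [← ofReal_integral_eq_lintegral_ofReal]
  · rw [← intervalIntegral.integral_of_le hs]
    congr 1
    simp only [intervalIntegral.integral_const_mul, intervalIntegral.integral_div, integral_pow,
      Nat.factorial_succ]
    push_cast
    field_simp
    simp
  · exact (Continuous.integrableOn_Ioc (by fun_prop))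
  · filter_upwards [ae_restrict_mem measurableSet_Ioc] with x hx
    have := hx.1
    positivity

lemma gammaMeasure_Iio (n : ℕ) (s : ℝ) :
    gammaMeasure ((n : ℝ) + 1) 1 (Set.Iio s) =
      ∫⁻ x in Set.Ioc 0 s, ENNReal.ofReal (x ^ n * exp (-x) / n.factorial) := by
  rw [gammaMeasure_natCast_add_one, withDensity_apply _ measurableSet_Iio,
    Measure.restrict_restrict measurableSet_Iio, Set.Iio_inter_Ioi, restrict_Ioo_eq_restrict_Ioc]

lemma gammaMeasure_Iio_le (n : ℕ) {s : ℝ} (hs : 0 ≤ s) :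
    gammaMeasure ((n : ℝ) + 1) 1 (Set.Iio s) ≤
      ENNReal.ofReal (s ^ (n + 1) / (n + 1).factorial) := by
  have h := lintegral_Ioc_const_mul_pow n zero_le_one hs
  simp only [one_mul] at h
  rw [gammaMeasure_Iio, ← h]
  refine setLIntegral_mono' measurableSet_Ioc fun x hx => ?_
  exact ENNReal.ofReal_le_ofReal (gammaDensity_le hx.1)

lemma le_gammaMeasure_Iio (n : ℕ) {s : ℝ} (hs : 0 ≤ s) :
    ENNReal.ofReal (exp (-s) * (s ^ (n + 1) / (n + 1).factorial)) ≤
      gammaMeasure ((n : ℝ) + 1) 1 (Set.Iio s) := by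
  rw [gammaMeasure_Iio, ← lintegral_Ioc_const_mul_pow n (exp_pos _).le hs]
  refine setLIntegral_mono' measurableSet_Ioc fun x hx => ?_
  refine ENNReal.ofReal_le_ofReal ?_
  have h : exp (-s) ≤ exp (-x) := exp_le_exp.2 (by linarith [hx.2])
  have hx0 := hx.1
  calc exp (-s) * (x ^ n / n.factorial) ≤ exp (-x) * (x ^ n / n.factorial) := by gcongr
    _ = _ := by ring

instance isProbabilityMeasure_gammaMeasure_natCast_add_one (n : ℕ) :
    IsProbabilityMeasure (gammaMeasure ((n : ℝ) + 1) 1) :=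
  isProbabilityMeasure_gammaMeasure (by positivity) one_pos

/-- The law of the product of two independent Gamma variables, conditioned on the second. -/
lemma gammaMeasure_prod_mul_lt (n : ℕ) (t : ℝ) :
    ((gammaMeasure ((n : ℝ) + 1) 1).prod (gammaMeasure ((n : ℝ) + 1) 1)) {p | p.1 * p.2 < t} =
      ∫⁻ w in Set.Ioi 0, ENNReal.ofReal (w ^ n * exp (-w) / n.factorial) *
        gammaMeasure ((n : ℝ) + 1) 1 (Set.Iio (t / w)) := by
  have hS : MeasurableSet {p : ℝ × ℝ | p.1 * p.2 < t} :=
    measurableSet_lt (by fun_prop) measurable_const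
  rw [Measure.prod_apply_symm hS]
  conv_lhs => arg 1; rw [gammaMeasure_natCast_add_one]
  rw [lintegral_withDensity_eq_lintegral_mul _ (measurable_gammaDensity n)
    (measurable_measure_prodMk_right hS)]
  refine setLIntegral_congr_fun measurableSet_Ioi fun w hw => ?_
  simp only [Pi.mul_apply]
  congr 2
  ext x
  simp [lt_div_iff₀ (show 0 < w from hw)]

lemma gammaMeasure_prod_mul_lt_le (n : ℕ) {t : ℝ} (ht : 0 < t) (ht1 : t ≤ 1) :
    ((gammaMeasure ((n : ℝ) + 1) 1).prod (gammaMeasure ((n : ℝ) + 1) 1)) {p | p.1 * p.2 < t} ≤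
      ENNReal.ofReal (t ^ (n + 1) / (n + 1).factorial * (2 + -log t / n.factorial)) := by
  have hlog : 0 ≤ -log t := by linarith [log_nonpos ht.le ht1]
  rw [gammaMeasure_prod_mul_lt, ← Set.Ioc_union_Ioi_eq_Ioi zero_le_one,
    ← Set.Ioc_union_Ioc_eq_Ioc ht.le ht1]
  have h₁ : ∫⁻ w in Set.Ioc 0 t, ENNReal.ofReal (w ^ n * exp (-w) / n.factorial) *
      gammaMeasure ((n : ℝ) + 1) 1 (Set.Iio (t / w)) ≤
      ENNReal.ofReal (t ^ (n + 1) / (n + 1).factorial) := by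
    refine le_trans ?_ (gammaMeasure_Iio_le n ht.le)
    rw [gammaMeasure_Iio]
    exact setLIntegral_mono' measurableSet_Ioc fun w _ => mul_le_of_le_one_right' prob_le_one
  have h₂ : ∫⁻ w in Set.Ioc t 1, ENNReal.ofReal (w ^ n * exp (-w) / n.factorial) *
      gammaMeasure ((n : ℝ) + 1) 1 (Set.Iio (t / w)) ≤
      ENNReal.ofReal (t ^ (n + 1) / (n + 1).factorial * (-log t / n.factorial)) := by
    calc _ ≤ ∫⁻ w in Set.Ioc t 1,
          ENNReal.ofReal (t ^ (n + 1) / (n + 1).factorial / n.factorial * (1 / w)) := by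
          refine setLIntegral_mono' measurableSet_Ioc fun w hw => ?_
          have hw0 : 0 < w := ht.trans hw.1
          refine (mul_le_mul' (ENNReal.ofReal_le_ofReal (gammaDensity_le hw0))
            (gammaMeasure_Iio_le n (by positivity))).trans_eq ?_
          rw [← ENNReal.ofReal_mul (by positivity)]
          congr 1
          rw [div_pow]
          field_simp
          ring
      _ = _ := by
          rw [← ofReal_integral_eq_lintegral_ofReal]
          · rw [← intervalIntegral.integral_of_le ht1, intervalIntegral.integral_const_mul,
              integral_one_div_of_pos ht one_pos, one_div, log_inv]
            congr 1
            ring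
          · refine IntegrableOn.mono_set (t := Set.Icc t 1) ?_ Set.Ioc_subset_Icc_self
            refine ContinuousOn.integrableOn_Icc ?_
            exact continuousOn_const.mul (continuousOn_const.div continuousOn_id
              fun w hw => (ht.trans_le hw.1).ne')
          · filter_upwards [ae_restrict_mem measurableSet_Ioc] with w hw
            have hw0 : 0 < w := ht.trans hw.1
            positivity
  have h₃ : ∫⁻ w in Set.Ioi 1, ENNReal.ofReal (w ^ n * exp (-w) / n.factorial) *
      gammaMeasure ((n : ℝ) + 1) 1 (Set.Iio (t / w)) ≤
      ENNReal.ofReal (t ^ (n + 1) / (n + 1).factorial) := by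
    calc _ ≤ ∫⁻ w in Set.Ioi 1, ENNReal.ofReal (w ^ n * exp (-w) / n.factorial) *
          ENNReal.ofReal (t ^ (n + 1) / (n + 1).factorial) := by
          refine setLIntegral_mono' measurableSet_Ioi fun w hw => ?_
          refine mul_le_mul' le_rfl (le_trans (measure_mono (Set.Iio_subset_Iio ?_))
            (gammaMeasure_Iio_le n ht.le))
          exact div_le_self ht.le (le_of_lt hw)
      _ ≤ 1 * ENNReal.ofReal (t ^ (n + 1) / (n + 1).factorial) := by
          rw [lintegral_mul_const _ (measurable_gammaDensity n)]
          gcongr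
          refine (lintegral_mono_set (Set.Ioi_subset_Ioi zero_le_one)).trans_eq ?_
          have h := measure_univ (μ := gammaMeasure ((n : ℝ) + 1) 1)
          rwa [gammaMeasure_natCast_add_one, withDensity_apply _ MeasurableSet.univ,
            Measure.restrict_univ] at h
      _ = _ := one_mul _
  refine (lintegral_union_le _ _ _).trans ((add_le_add (lintegral_union_le _ _ _) le_rfl).trans ?_)
  refine (add_le_add (add_le_add h₁ h₂) h₃).trans_eq ?_
  rw [← ENNReal.ofReal_add (by positivity) (by positivity),
    ← ENNReal.ofReal_add (by positivity) (by positivity)]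
  congr 1
  ring

lemma le_gammaMeasure_prod_mul_lt (n : ℕ) {t : ℝ} (ht : 0 < t) (ht1 : t ≤ 1) :
    ENNReal.ofReal (t ^ (n + 1) / (n + 1).factorial / n.factorial * (-log t - 2)) ≤
    ((gammaMeasure ((n : ℝ) + 1) 1).prod (gammaMeasure ((n : ℝ) + 1) 1)) {p | p.1 * p.2 < t} := by
  rw [gammaMeasure_prod_mul_lt]
  set c : ℝ := t ^ (n + 1) / (n + 1).factorial / n.factorial with hc
  have hc0 : 0 ≤ c := by positivity
  have hcont {k : ℕ} : ContinuousOn (fun w : ℝ => 1 / w ^ k) (Set.uIcc t 1) := by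
    rw [Set.uIcc_of_le ht1]
    exact continuousOn_const.div (by fun_prop) fun w hw => pow_ne_zero _ (ht.trans_le hw.1).ne'
  have hi₁ : IntervalIntegrable (fun w : ℝ => 1 / w) volume t 1 := by
    simpa using (hcont (k := 1)).intervalIntegrable (μ := volume)
  have hi : IntervalIntegrable (fun w : ℝ => 1 / w ^ 2) volume t 1 :=
    (hcont (k := 2)).intervalIntegrable
  have hi₂ : IntervalIntegrable (fun w : ℝ => t * (1 / w ^ 2)) volume t 1 :=
    hi.const_mul t
  have hsq : ∫ w in t..1, 1 / w ^ 2 = 1 / t - 1 := by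
    have h : ∀ w ∈ Set.uIcc t 1, HasDerivAt (fun x : ℝ => -x⁻¹) (1 / w ^ 2) w := by
      intro w hw
      rw [Set.uIcc_of_le ht1] at hw
      rw [one_div, ← neg_neg (w ^ 2)⁻¹]
      exact (hasDerivAt_inv (ht.trans_le hw.1).ne').fun_neg
    rw [intervalIntegral.integral_eq_sub_of_hasDerivAt h hi]
    simp
    ring
  have hint : ∫ w in t..1, (1 / w - 1 - t * (1 / w ^ 2)) = -log t - 2 * (1 - t) := by
    rw [intervalIntegral.integral_sub (hi₁.sub intervalIntegrable_const) hi₂,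
      intervalIntegral.integral_sub hi₁ intervalIntegrable_const,
      integral_one_div_of_pos ht one_pos, intervalIntegral.integral_const_mul, hsq, one_div,
      log_inv]
    simp
    field_simp
    ring
  calc ENNReal.ofReal (c * (-log t - 2))
      ≤ ENNReal.ofReal (∫ w in Set.Ioc t 1, c * (1 / w - 1 - t * (1 / w ^ 2))) := by
        rw [← intervalIntegral.integral_of_le ht1, intervalIntegral.integral_const_mul, hint]
        gcongr
        linarith
    _ ≤ ∫⁻ w in Set.Ioc t 1, ENNReal.ofReal (c * (1 / w - 1 - t * (1 / w ^ 2))) := by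
        have hf : IntervalIntegrable (fun w => c * (1 / w - 1 - t * (1 / w ^ 2))) volume t 1 :=
          ((hi₁.sub intervalIntegrable_const).sub hi₂).const_mul c
        rw [integral_eq_lintegral_pos_part_sub_lintegral_neg_part hf.1]
        exact (ENNReal.ofReal_le_ofReal (sub_le_self _ ENNReal.toReal_nonneg)).trans
          ENNReal.ofReal_toReal_le
    _ ≤ ∫⁻ w in Set.Ioc t 1, ENNReal.ofReal (w ^ n * exp (-w) / n.factorial) *
        gammaMeasure ((n : ℝ) + 1) 1 (Set.Iio (t / w)) := by
        refine setLIntegral_mono' measurableSet_Ioc fun w hw => ?_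
        have hw0 : 0 < w := ht.trans hw.1
        refine le_trans ?_ (mul_le_mul' le_rfl (le_gammaMeasure_Iio n (by positivity)))
        rw [← ENNReal.ofReal_mul (by positivity)]
        refine ENNReal.ofReal_le_ofReal ?_
        have h : 1 - w - t / w ≤ exp (-w) * exp (-(t / w)) := by
          rw [← exp_add]
          linarith [add_one_le_exp (-w + -(t / w))]
        calc c * (1 / w - 1 - t * (1 / w ^ 2)) = c / w * (1 - w - t / w) := by field_simp
          _ ≤ c / w * (exp (-w) * exp (-(t / w))) := by gcongr
          _ = _ := by
            rw [hc, div_pow]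
            field_simp
            ring
    _ ≤ _ := lintegral_mono_set fun w hw => ht.trans hw.1

lemma tendsto_const_add_mul_log_div_log (a b : ℝ) :
    Tendsto (fun ρ : ℝ => (a + b * log ρ) / log ρ) atTop (nhds b) := by
  have h : Tendsto (fun ρ : ℝ => a / log ρ + b) atTop (nhds (0 + b)) :=
    (tendsto_log_atTop.const_div_atTop a).add_const b
  rw [zero_add] at h
  refine h.congr' ?_
  filter_upwards [eventually_gt_atTop 1] with ρ hρ
  have := (log_pos hρ).ne'
  field_simp

/-- Proposition 1, case `M_T = M_R + 1`: the TZF outage probability decays like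
`ρ^{−M_R} ln ρ`, with
`lim_{ρ→∞} ρ^{M_R} F(ρ)/ln ρ = (d₁^τ z)^{M_R} (d₂^τ/κ)^{M_R}/(Γ(M_R+1)Γ(M_R))`. -/
theorem tzf_high_snr_MT_eq {Ω : Type*} {mΩ : MeasurableSpace Ω}
    (μ : Measure Ω) [IsProbabilityMeasure μ]
    (MR MT : ℕ) (hMR : 1 ≤ MR) (hMT : MT = MR + 1)
    (d1 d2 η α : ℝ) (hd1 : 0 < d1) (hd2 : 0 < d2)
    (hη : 0 < η) (hα0 : 0 < α) (hα1 : α < 1)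
    (κ : ℝ) (hκ : κ = η * α / (1 - α))
    (X W : Ω → ℝ) (hX : Measurable X) (hW : Measurable W)
    (hXlaw : μ.map X = gammaMeasure (MR : ℝ) 1)
    (hWlaw : μ.map W = gammaMeasure ((MT : ℝ) - 1) 1)
    (hindep : IndepFun X W μ)
    (z : ℝ) (hz : 0 < z)
    (F : ℝ → ℝ)
    (hF : ∀ ρ : ℝ, 0 < ρ →
      F ρ = (μ {ω | ρ / ((1 - α) * d1) * X ω * min (1 - α) (η * α / d2 * W ω) < z}).toReal) :
    Tendsto (fun ρ : ℝ => ρ ^ MR * F ρ / Real.log ρ) atTop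
      (nhds ((d1 * z) ^ MR * (d2 / κ) ^ MR
        / (Real.Gamma ((MR : ℝ) + 1) * Real.Gamma (MR : ℝ)))) := by
  obtain ⟨n, rfl⟩ : ∃ n, MR = n + 1 := ⟨MR - 1, by omega⟩
  subst hMT
  have hα : 0 < 1 - α := by linarith
  have hκ0 : 0 < κ := by rw [hκ]; positivity
  push_cast at hXlaw hWlaw
  rw [add_sub_cancel_right] at hWlaw
  have hpos : ∀ᵐ ω ∂μ, 0 < X ω := by
    have h : ∀ᵐ x ∂(μ.map X), 0 < x := by
      rw [hXlaw, gammaMeasure_natCast_add_one]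
      exact (withDensity_absolutelyContinuous _ _).ae_le (ae_restrict_mem measurableSet_Ioi)
    exact ae_of_ae_map hX.aemeasurable h
  have hprod (t : ℝ) : μ {ω | X ω * W ω < t} =
      ((gammaMeasure ((n : ℝ) + 1) 1).prod (gammaMeasure ((n : ℝ) + 1) 1))
        {p | p.1 * p.2 < t} := by
    have h := (indepFun_iff_map_prod_eq_prod_map_map hX.aemeasurable hW.aemeasurable).1 hindep
    rw [hXlaw, hWlaw] at h
    rw [← h, Measure.map_apply (hX.prodMk hW) (measurableSet_lt (by fun_prop) measurable_const)]
    rfl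
  have hfirst (s : ℝ) : μ {ω | X ω < s} = gammaMeasure ((n : ℝ) + 1) 1 (Set.Iio s) := by
    rw [← hXlaw, Measure.map_apply hX measurableSet_Iio]
    rfl
  set c : ℝ := d1 * z with hc
  set b : ℝ := c * (d2 / κ) with hb
  have hc0 : 0 < c := by positivity
  have hb0 : 0 < b := by positivity
  set N : ℝ := ((n + 1).factorial : ℝ) with hN
  set K : ℝ := (n.factorial : ℝ) with hK
  have hN0 : 0 < N := by positivity
  have hK0 : 0 < K := by positivity
  have hlim : c ^ (n + 1) * (d2 / κ) ^ (n + 1) /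
      (Real.Gamma (((n + 1 : ℕ) : ℝ) + 1) * Real.Gamma ((n + 1 : ℕ) : ℝ)) =
      b ^ (n + 1) / N / K := by
    rw [Real.Gamma_nat_eq_factorial, Nat.cast_add_one n, Real.Gamma_nat_eq_factorial, hb, ← mul_pow,
      div_div]
  rw [hlim]
  have hscale {ρ : ℝ} (hρ : 0 < ρ) (x : ℝ) :
      (ρ / ((1 - α) * d1) * x * (1 - α) < z ↔ x < c / ρ) := by
    rw [lt_div_iff₀ hρ, hc, show ρ / ((1 - α) * d1) * x * (1 - α) = x * ρ / d1 by field_simp,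
      div_lt_iff₀ hd1, mul_comm z]
  have hscale' {ρ : ℝ} (hρ : 0 < ρ) (x w : ℝ) :
      (ρ / ((1 - α) * d1) * x * (η * α / d2 * w) < z ↔ x * w < b / ρ) := by
    rw [lt_div_iff₀ hρ, hb, hc, ← mul_div_assoc, lt_div_iff₀ hκ0, ← div_lt_iff₀ hd2,
      ← div_lt_iff₀' hd1,
      show ρ / ((1 - α) * d1) * x * (η * α / d2 * w) = x * w * ρ * κ / d2 / d1 by
        rw [hκ]; field_simp]
  refine tendsto_of_tendsto_of_tendsto_of_le_of_le'
    (tendsto_const_add_mul_log_div_log (b ^ (n + 1) / N / K * (-log b - 2)) _)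
    (tendsto_const_add_mul_log_div_log
      (c ^ (n + 1) / N + b ^ (n + 1) / N * (2 - log b / K)) _) ?_ ?_
  · filter_upwards [eventually_gt_atTop 1, eventually_ge_atTop b] with ρ hρ hbρ
    have hρ0 : 0 < ρ := by linarith
    have hlog := log_pos hρ
    have ht : 0 < b / ρ := by positivity
    have ht1 : b / ρ ≤ 1 := (div_le_one hρ0).2 hbρ
    have h : b ^ (n + 1) / ρ ^ (n + 1) / N / K * (-(log b - log ρ) - 2) ≤ F ρ := by
      rw [hF ρ hρ0, ← log_div hb0.ne' hρ0.ne', ← div_pow]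
      refine (ENNReal.ofReal_le_iff_le_toReal (measure_ne_top _ _)).1 ?_
      refine (le_gammaMeasure_prod_mul_lt n ht ht1).trans ?_
      rw [← hprod]
      refine measure_mono_ae ?_
      filter_upwards [hpos] with ω hω hlt
      refine lt_of_le_of_lt ?_ ((hscale' hρ0 _ _).2 hlt)
      exact mul_le_mul_of_nonneg_left (min_le_right _ _) (by positivity)
    gcongr
    refine le_trans (le_of_eq ?_) (mul_le_mul_of_nonneg_left h (by positivity))
    field_simp
    ring
  · filter_upwards [eventually_gt_atTop 1, eventually_ge_atTop b] with ρ hρ hbρ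
    have hρ0 : 0 < ρ := by linarith
    have hlog := log_pos hρ
    have ht : 0 < b / ρ := by positivity
    have ht1 : b / ρ ≤ 1 := (div_le_one hρ0).2 hbρ
    have hlogt : 0 ≤ -log (b / ρ) := by linarith [log_nonpos ht.le ht1]
    have h : F ρ ≤ c ^ (n + 1) / ρ ^ (n + 1) / N +
        b ^ (n + 1) / ρ ^ (n + 1) / N * (2 + -(log b - log ρ) / K) := by
      rw [hF ρ hρ0, ← log_div hb0.ne' hρ0.ne', ← div_pow, ← div_pow]
      refine ENNReal.toReal_le_of_le_ofReal (by positivity) ?_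
      rw [ENNReal.ofReal_add (by positivity) (by positivity)]
      refine le_trans ?_ (add_le_add (gammaMeasure_Iio_le n (by positivity))
        (gammaMeasure_prod_mul_lt_le n ht ht1))
      rw [← hprod, ← hfirst]
      refine (measure_mono fun ω hω => ?_).trans (measure_union_le _ _)
      rcases min_choice (1 - α) (η * α / d2 * W ω) with hm | hm
      · left
        rw [Set.mem_ofPred_eq, hm] at hω
        exact (hscale hρ0 _).1 hω
      · right
        rw [Set.mem_ofPred_eq, hm] at hω
        exact (hscale' hρ0 _ _).1 hω
    gcongr
    refine (mul_le_mul_of_nonneg_left h (by positivity)).trans (le_of_eq ?_)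
    field_simp
    ring
end

section
/- (Proposition 1, case M_T < M_R + 1.) Let M_T ≥ 2 and M_R be integers with M_T ≤ M_R, let d₁^τ > 0, d₂^τ > 0, η > 0, α ∈ (0,1) be reals, set κ = ηα/(1−α), and fix z > 0. For ρ > 0 let X, W be independent with X ~ Gamma(M_R, 1), W ~ Gamma(M_T−1, 1), and let F(ρ) = ℙ( (ρ/((1−α) d₁^τ)) X min(1−α, (ηα/d₂^τ) W) < z ) be the outage probability of the TZF scheme at first-hop SNR ρ. Then lim_{ρ→∞} ρ^{M_T−1} F(ρ) = (Γ(M_R − M_T + 1)/(Γ(M_T) Γ(M_R))) (d₂^τ/κ)^{M_T−1} (d₁^τ z)^{M_T−1}. -/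
open MeasureTheory ProbabilityTheory Real Filter

lemma ae_gammaMeasure_pos (a r : ℝ) : ∀ᵐ x ∂gammaMeasure a r, 0 < x := by
  rw [gammaMeasure, ae_withDensity_iff (f := gammaPDF a r)
    (measurable_gammaPDFReal a r).ennreal_ofReal]
  filter_upwards [Measure.ae_ne volume (0 : ℝ)] with x hx0 hx
  by_contra h
  exact hx (gammaPDF_of_neg (lt_of_le_of_ne (not_lt.mp h) hx0))

lemma toReal_gammaPDF {a r : ℝ} (ha : 0 < a) (hr : 0 < r) (x : ℝ) :
    (gammaPDF a r x).toReal = gammaPDFReal a r x :=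
  ENNReal.toReal_ofReal (gammaPDFReal_nonneg ha hr x)

lemma integral_gammaMeasure_one {a : ℝ} (ha : 0 < a) (f : ℝ → ℝ) :
    ∫ x, f x ∂gammaMeasure a 1 =
      ∫ x in Set.Ioi 0, (Gamma a)⁻¹ * (x ^ (a - 1) * exp (-x)) * f x := by
  rw [gammaMeasure, integral_withDensity_eq_integral_toReal_smul
    (f := gammaPDF a 1) (measurable_gammaPDFReal a 1).ennreal_ofReal
    (ae_of_all _ fun _ => ENNReal.ofReal_lt_top), ← integral_Ici_eq_integral_Ioi,
    ← integral_indicator measurableSet_Ici]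
  refine integral_congr_ae (ae_of_all _ fun x => ?_)
  simp only [toReal_gammaPDF ha one_pos, gammaPDFReal, Set.indicator_apply, Set.mem_Ici, smul_eq_mul]
  split_ifs <;> simp [mul_assoc]

lemma integrable_rpow_neg_gammaMeasure_one {a b : ℝ} (hb : 0 < b) (hab : a < b) :
    Integrable (fun x => x ^ (-a)) (gammaMeasure b 1) := by
  rw [gammaMeasure, integrable_withDensity_iff_integrable_smul'
    (f := gammaPDF b 1) (measurable_gammaPDFReal b 1).ennreal_ofReal
    (ae_of_all _ fun _ => ENNReal.ofReal_lt_top)]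
  have h := ((GammaIntegral_convergent (sub_pos.mpr hab)).const_mul (Gamma b)⁻¹)
  rw [← IntegrableOn, ← integrable_indicator_iff measurableSet_Ioi] at h
  refine h.congr ?_
  filter_upwards [Measure.ae_ne volume (0 : ℝ)] with x hx0
  simp only [toReal_gammaPDF hb one_pos, gammaPDFReal, Set.indicator_apply, Set.mem_Ioi, smul_eq_mul]
  rcases lt_or_gt_of_ne hx0 with hx | hx
  · simp [hx.not_gt, hx.not_ge]
  · have : x ^ (b - a - 1) = x ^ (b - 1) * x ^ (-a) := by rw [← rpow_add hx]; ring_nf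
    simp only [hx, hx.le, this, if_true, one_rpow, one_mul]
    ring

lemma integral_rpow_neg_gammaMeasure_one {a b : ℝ} (hb : 0 < b) (hab : a < b) :
    ∫ x, x ^ (-a) ∂gammaMeasure b 1 = Gamma (b - a) / Gamma b := by
  rw [integral_gammaMeasure_one hb, Gamma_eq_integral (sub_pos.mpr hab), div_eq_inv_mul,
    ← integral_const_mul]
  refine setIntegral_congr_fun measurableSet_Ioi fun x hx => ?_
  have : x ^ (b - a - 1) = x ^ (b - 1) * x ^ (-a) := by rw [← rpow_add hx]; ring_nf
  simp only [this]; ring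

lemma gammaMeasure_one_real_Iio {a y : ℝ} (ha : 0 < a) (hy : 0 ≤ y) :
    (gammaMeasure a 1).real (Set.Iio y) =
      (Gamma a)⁻¹ * ∫ x in (0 : ℝ)..y, x ^ (a - 1) * exp (-x) := by
  rw [← integral_indicator_one measurableSet_Iio, integral_gammaMeasure_one ha,
    intervalIntegral.integral_of_le hy, ← integral_const_mul, integral_Ioc_eq_integral_Ioo,
    ← Set.Ioi_inter_Iio, ← setIntegral_indicator measurableSet_Iio]
  refine setIntegral_congr_fun measurableSet_Ioi fun x _ => ?_
  simp [Set.indicator_apply]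

lemma intervalIntegrable_rpow_sub_one_mul_exp_neg {a y : ℝ} (ha : 0 < a) :
    IntervalIntegrable (fun x => x ^ (a - 1) * exp (-x)) volume 0 y :=
  (intervalIntegral.intervalIntegrable_rpow' (by linarith)).mul_continuousOn (by fun_prop)

lemma integral_rpow_sub_one_mul_const {a : ℝ} (ha : 0 < a) (y c : ℝ) :
    (Gamma a)⁻¹ * ∫ x in (0 : ℝ)..y, x ^ (a - 1) * c = y ^ a / Gamma (a + 1) * c := by
  rw [intervalIntegral.integral_mul_const, integral_rpow (Or.inl (by linarith)),
    Gamma_add_one ha.ne', sub_add_cancel, zero_rpow ha.ne']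
  have := (Gamma_pos_of_pos ha).ne'
  field_simp
  ring

lemma gammaMeasure_one_real_Iio_le {a y : ℝ} (ha : 0 < a) (hy : 0 ≤ y) :
    (gammaMeasure a 1).real (Set.Iio y) ≤ y ^ a / Gamma (a + 1) := by
  rw [gammaMeasure_one_real_Iio ha hy, ← mul_one (y ^ a / _),
    ← integral_rpow_sub_one_mul_const ha]
  refine mul_le_mul_of_nonneg_left ?_ (inv_nonneg.mpr (Gamma_pos_of_pos ha).le)
  refine intervalIntegral.integral_mono_on hy (intervalIntegrable_rpow_sub_one_mul_exp_neg ha)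
    ((intervalIntegral.intervalIntegrable_rpow' (by linarith)).mul_const _) fun x hx => ?_
  exact mul_le_mul_of_nonneg_left (exp_le_one_iff.mpr (by linarith [hx.1])) (rpow_nonneg hx.1 _)

lemma le_gammaMeasure_one_real_Iio {a y : ℝ} (ha : 0 < a) (hy : 0 ≤ y) :
    y ^ a / Gamma (a + 1) * exp (-y) ≤ (gammaMeasure a 1).real (Set.Iio y) := by
  rw [gammaMeasure_one_real_Iio ha hy, ← integral_rpow_sub_one_mul_const ha]
  refine mul_le_mul_of_nonneg_left ?_ (inv_nonneg.mpr (Gamma_pos_of_pos ha).le)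
  refine intervalIntegral.integral_mono_on hy
    ((intervalIntegral.intervalIntegrable_rpow' (by linarith)).mul_const _)
    (intervalIntegrable_rpow_sub_one_mul_exp_neg ha) fun x hx => ?_
  exact mul_le_mul_of_nonneg_left (exp_le_exp.mpr (by linarith [hx.2])) (rpow_nonneg hx.1 _)

lemma setOf_mul_min_one_div_lt {c t x : ℝ} (hc : 0 < c) (ht : 0 < t) (htx : t < x) :
    {w : ℝ | x * min 1 (w / c) < t} = Set.Iio (c / x * t) := by
  have hx := ht.trans htx
  ext w
  simp only [Set.mem_ofPred_eq, Set.mem_Iio]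
  rw [← lt_div_iff₀' hx, min_lt_iff, div_lt_iff₀ hc, or_iff_right (by
    rw [not_lt]; exact ((div_lt_one hx).mpr htx).le)]
  ring_nf

lemma tendsto_rpow_neg_mul_gammaMeasure_section {a c x : ℝ} (ha : 0 < a) (hc : 0 < c)
    (hx : 0 < x) :
    Tendsto (fun t => t ^ (-a) * (gammaMeasure a 1).real {w | x * min 1 (w / c) < t})
      (nhdsWithin 0 (Set.Ioi 0)) (nhds (c ^ a / Gamma (a + 1) * x ^ (-a))) := by
  have hcx : 0 < c / x := by positivity
  have hconst : c ^ a / Gamma (a + 1) * x ^ (-a) = (c / x) ^ a / Gamma (a + 1) := by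
    rw [div_rpow hc.le hx.le, rpow_neg hx.le]; ring
  have hmem : ∀ᶠ t in nhdsWithin (0 : ℝ) (Set.Ioi 0), 0 < t ∧ t < x :=
    Ioo_mem_nhdsGT hx
  have hscale {t : ℝ} (ht : 0 < t) :
      (c / x) ^ a / Gamma (a + 1) = t ^ (-a) * ((c / x * t) ^ a / Gamma (a + 1)) := by
    rw [mul_rpow hcx.le ht.le, rpow_neg ht.le]
    have := (rpow_pos_of_pos ht a).ne'
    field_simp
  rw [hconst]
  have hlow : Tendsto (fun t => (c / x) ^ a / Gamma (a + 1) * exp (-(c / x * t)))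
      (nhdsWithin 0 (Set.Ioi 0)) (nhds ((c / x) ^ a / Gamma (a + 1))) := by
    have : Continuous fun t => (c / x) ^ a / Gamma (a + 1) * exp (-(c / x * t)) := by fun_prop
    simpa using (this.tendsto 0).mono_left nhdsWithin_le_nhds
  refine tendsto_of_tendsto_of_tendsto_of_le_of_le' hlow tendsto_const_nhds ?_ ?_
  · filter_upwards [hmem] with t ht
    rw [setOf_mul_min_one_div_lt hc ht.1 ht.2, hscale ht.1, mul_assoc]
    exact mul_le_mul_of_nonneg_left
      (le_gammaMeasure_one_real_Iio ha (mul_pos hcx ht.1).le) (rpow_nonneg ht.1.le _)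
  · filter_upwards [hmem] with t ht
    rw [setOf_mul_min_one_div_lt hc ht.1 ht.2, hscale ht.1]
    exact mul_le_mul_of_nonneg_left
      (gammaMeasure_one_real_Iio_le ha (mul_pos hcx ht.1).le) (rpow_nonneg ht.1.le _)

lemma rpow_neg_mul_gammaMeasure_section_le {a c x t : ℝ} (ha : 0 < a) (hc : 0 < c)
    (hx : 0 < x) (ht : 0 < t) :
    t ^ (-a) * (gammaMeasure a 1).real {w | x * min 1 (w / c) < t} ≤
      (1 + c ^ a / Gamma (a + 1)) * x ^ (-a) := by
  have := isProbabilityMeasure_gammaMeasure ha one_pos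
  have hG := Gamma_pos_of_pos (add_pos ha one_pos)
  have hxa := rpow_pos_of_pos hx (-a)
  rcases lt_or_ge t x with htx | hxt
  · rw [setOf_mul_min_one_div_lt hc ht htx]
    calc _ ≤ t ^ (-a) * ((c / x * t) ^ a / Gamma (a + 1)) := by
          gcongr
          exact gammaMeasure_one_real_Iio_le ha (by positivity)
      _ = c ^ a / Gamma (a + 1) * x ^ (-a) := by
          rw [mul_rpow (by positivity) ht.le, div_rpow hc.le hx.le, rpow_neg ht.le,
            rpow_neg hx.le]
          have := (rpow_pos_of_pos ht a).ne'
          field_simp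
      _ ≤ _ := by gcongr; linarith
  · calc _ ≤ t ^ (-a) * 1 := by gcongr; exact measureReal_le_one
      _ ≤ 1 * x ^ (-a) := by
          rw [mul_one, one_mul]
          exact rpow_le_rpow_of_nonpos hx hxt (by linarith)
      _ ≤ _ := by
          gcongr
          have : 0 ≤ c ^ a / Gamma (a + 1) := by positivity
          linarith

lemma measurableSet_mul_min_one_div_lt (c t : ℝ) :
    MeasurableSet {p : ℝ × ℝ | p.1 * min 1 (p.2 / c) < t} :=
  measurableSet_lt (by fun_prop) measurable_const

/-- For independent `X ~ Gamma(b, 1)`, `W ~ Gamma(a, 1)` with `0 < a < b`, the probability that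
`X * min 1 (W / c) < t` is asymptotic to `c ^ a * Γ(b - a) / (Γ(a + 1) * Γ(b)) * t ^ a`
as `t → 0⁺`. -/
lemma tendsto_rpow_neg_mul_gammaMeasure_prod {a b c : ℝ} (ha : 0 < a) (hab : a < b)
    (hc : 0 < c) :
    Tendsto (fun t => t ^ (-a) * ((gammaMeasure b 1).prod (gammaMeasure a 1)).real
        {p : ℝ × ℝ | p.1 * min 1 (p.2 / c) < t})
      (nhdsWithin 0 (Set.Ioi 0))
      (nhds (c ^ a / Gamma (a + 1) * (Gamma (b - a) / Gamma b))) := by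
  have hb := ha.trans hab
  have := isProbabilityMeasure_gammaMeasure ha one_pos
  have := isProbabilityMeasure_gammaMeasure hb one_pos
  have hmeas (t : ℝ) : Measurable fun x =>
      (gammaMeasure a 1).real {w | x * min 1 (w / c) < t} :=
    (measurable_measure_prodMk_left (measurableSet_mul_min_one_div_lt c t)).ennreal_toReal
  have hsection (t : ℝ) : t ^ (-a) * ((gammaMeasure b 1).prod (gammaMeasure a 1)).real
        {p : ℝ × ℝ | p.1 * min 1 (p.2 / c) < t} =
      ∫ x, t ^ (-a) * (gammaMeasure a 1).real {w | x * min 1 (w / c) < t}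
        ∂gammaMeasure b 1 := by
    rw [integral_const_mul, measureReal_def,
      Measure.prod_apply (measurableSet_mul_min_one_div_lt c t)]
    congr 1
    exact (integral_toReal
      (measurable_measure_prodMk_left (measurableSet_mul_min_one_div_lt c t)).aemeasurable
      (ae_of_all _ fun _ => measure_lt_top _ _)).symm
  simp_rw [hsection]
  rw [← integral_rpow_neg_gammaMeasure_one hb hab, ← integral_const_mul]
  refine tendsto_integral_filter_of_dominated_convergence
    (fun x => (1 + c ^ a / Gamma (a + 1)) * x ^ (-a))
    (Eventually.of_forall fun t => ((hmeas t).const_mul _).aestronglyMeasurable) ?_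
    ((integrable_rpow_neg_gammaMeasure_one hb hab).const_mul _) ?_
  · filter_upwards [self_mem_nhdsWithin] with t ht
    filter_upwards [ae_gammaMeasure_pos b 1] with x hx
    rw [norm_of_nonneg (mul_nonneg (rpow_nonneg (le_of_lt ht) _) measureReal_nonneg)]
    exact rpow_neg_mul_gammaMeasure_section_le ha hc hx ht
  · filter_upwards [ae_gammaMeasure_pos b 1] with x hx
    exact tendsto_rpow_neg_mul_gammaMeasure_section ha hc hx

/-- Proposition 1, case `M_T < M_R + 1`: the TZF outage probability satisfies
`lim_{ρ→∞} ρ^{M_T−1} F(ρ) = (Γ(M_R−M_T+1)/(Γ(M_T)Γ(M_R))) (d₂^τ/κ)^{M_T−1} (d₁^τ z)^{M_T−1}`,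
showing diversity order `M_T − 1` in this regime. -/
theorem tzf_high_snr_MT_lt {Ω : Type*} {mΩ : MeasurableSpace Ω}
    (μ : Measure Ω) [IsProbabilityMeasure μ]
    (MR MT : ℕ) (hMT : 2 ≤ MT) (hMTMR : MT ≤ MR)
    (d1 d2 η α : ℝ) (hd1 : 0 < d1) (hd2 : 0 < d2)
    (hη : 0 < η) (hα0 : 0 < α) (hα1 : α < 1)
    (κ : ℝ) (hκ : κ = η * α / (1 - α))
    (X W : Ω → ℝ) (hX : Measurable X) (hW : Measurable W)
    (hXlaw : μ.map X = gammaMeasure (MR : ℝ) 1)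
    (hWlaw : μ.map W = gammaMeasure ((MT : ℝ) - 1) 1)
    (hindep : IndepFun X W μ)
    (z : ℝ) (hz : 0 < z)
    (F : ℝ → ℝ)
    (hF : ∀ ρ : ℝ, 0 < ρ →
      F ρ = (μ {ω | ρ / ((1 - α) * d1) * X ω * min (1 - α) (η * α / d2 * W ω) < z}).toReal) :
    Tendsto (fun ρ : ℝ => ρ ^ (MT - 1) * F ρ) atTop
      (nhds (Real.Gamma ((MR : ℝ) - MT + 1) / (Real.Gamma (MT : ℝ) * Real.Gamma (MR : ℝ))
        * (d2 / κ) ^ (MT - 1) * (d1 * z) ^ (MT - 1))) := by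
  have hα : 0 < 1 - α := sub_pos.mpr hα1
  have hκ0 : 0 < κ := by rw [hκ]; positivity
  have hcast : ((MT - 1 : ℕ) : ℝ) = (MT : ℝ) - 1 := by
    rw [Nat.cast_sub (by omega), Nat.cast_one]
  have hMT' : (2 : ℝ) ≤ MT := by exact_mod_cast hMT
  have hMR' : (MT : ℝ) ≤ MR := by exact_mod_cast hMTMR
  have hlim := tendsto_rpow_neg_mul_gammaMeasure_prod (a := (MT : ℝ) - 1) (b := MR)
    (c := d2 / κ) (by linarith) (by linarith) (by positivity)
  have ht : Tendsto (fun ρ : ℝ => d1 * z / ρ) atTop (nhdsWithin 0 (Set.Ioi 0)) :=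
    tendsto_nhdsWithin_iff.mpr ⟨tendsto_const_nhds.div_atTop tendsto_id,
      (eventually_gt_atTop 0).mono fun ρ hρ => div_pos (mul_pos hd1 hz) hρ⟩
  have hmul := (hlim.comp ht).const_mul ((d1 * z) ^ (MT - 1))
  have hconst : Real.Gamma ((MR : ℝ) - MT + 1) / (Real.Gamma (MT : ℝ) * Real.Gamma (MR : ℝ))
        * (d2 / κ) ^ (MT - 1) * (d1 * z) ^ (MT - 1) =
      (d1 * z) ^ (MT - 1) * ((d2 / κ) ^ ((MT : ℝ) - 1) / Gamma ((MT : ℝ) - 1 + 1) *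
        (Gamma (MR - ((MT : ℝ) - 1)) / Gamma MR)) := by
    rw [← hcast, rpow_natCast, hcast, sub_add_cancel, ← sub_add]
    ring
  rw [hconst]
  refine hmul.congr' ?_
  filter_upwards [eventually_gt_atTop 0] with ρ hρ
  have hset : {ω | ρ / ((1 - α) * d1) * X ω * min (1 - α) (η * α / d2 * W ω) < z} =
      (fun ω => (X ω, W ω)) ⁻¹' {p | p.1 * min 1 (p.2 / (d2 / κ)) < d1 * z / ρ} := by
    ext ω
    have hmin : min (1 - α) (η * α / d2 * W ω) = (1 - α) * min 1 (W ω / (d2 / κ)) := by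
      rw [mul_min_of_nonneg _ _ hα.le, mul_one, hκ]
      congr 1
      field_simp
    have hprod : ρ / ((1 - α) * d1) * X ω * ((1 - α) * min 1 (W ω / (d2 / κ))) =
        X ω * min 1 (W ω / (d2 / κ)) * ρ / d1 := by
      field_simp
    simp only [Set.mem_ofPred_eq, Set.mem_preimage]
    rw [hmin, hprod, lt_div_iff₀ hρ, div_lt_iff₀' hd1]
  have hpow : (ρ : ℝ) ^ (MT - 1) =
      (d1 * z) ^ (MT - 1) * (d1 * z / ρ) ^ (-((MT : ℝ) - 1)) := by
    rw [rpow_neg (by positivity), ← hcast, rpow_natCast, div_pow]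
    field_simp
  rw [hF ρ hρ, hset, ← Measure.map_apply (hX.prodMk hW) (measurableSet_mul_min_one_div_lt _ _),
    (indepFun_iff_map_prod_eq_prod_map_map hX.aemeasurable hW.aemeasurable).mp hindep,
    hXlaw, hWlaw, hpow, ← measureReal_def]
  simp only [Function.comp_apply, mul_assoc]
end

section
/- Let M_R, M_T ≥ 1 be integers, let h ∈ ℂ^{M_R} be nonzero, let H be an M_R × M_T complex matrix, and let g ∈ ℂ^{M_T}. Assume a := H* h ≠ 0 and, with B := I − a a*/‖a‖², assume B g ≠ 0. Let w_r = h/‖h‖ and w_t = B g/‖B g‖. Let P_S, d₁^τ, d₂^τ, η > 0 and α ∈ (0,1) be reals and set κ = ηα/(1−α). Then w_r* H w_t = 0, and consequently min( P_S |w_r* h|² / (κ P_S ‖h‖² |w_r* H w_t|² + d₁^τ), (κ P_S/(d₁^τ d₂^τ)) ‖h‖² |g* w_t|² ) = (P_S/((1−α) d₁^τ)) ‖h‖² · min( 1−α, (ηα/d₂^τ) ‖B g‖² ). -/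
open Matrix Complex

/-- The squared Euclidean norm of a complex vector as a dot product. -/
theorem star_dotProduct_self_eq_sum_normSq {ι : Type*} [Fintype ι] (v : ι → ℂ) :
    star v ⬝ᵥ v = ((∑ i, Complex.normSq (v i) : ℝ) : ℂ) := by
  simp [dotProduct, Complex.normSq_eq_conj_mul_self]

theorem sum_normSq_pos {ι : Type*} [Fintype ι] {v : ι → ℂ} (hv : v ≠ 0) :
    0 < ∑ i, Complex.normSq (v i) := by
  obtain ⟨i, hi⟩ := Function.ne_iff.mp hv
  exact Finset.sum_pos' (fun j _ => Complex.normSq_nonneg _)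
    ⟨i, Finset.mem_univ i, Complex.normSq_pos.mpr hi⟩

/-- The rank-one correction `I - c a a*` acts by subtracting a multiple of `a`. -/
theorem one_sub_smul_vecMulVec_star_mulVec {ι : Type*} [Fintype ι] [DecidableEq ι]
    (c : ℂ) (a g : ι → ℂ) :
    ((1 : Matrix ι ι ℂ) - c • Matrix.vecMulVec a (star a)).mulVec g
      = g - (c * (star a ⬝ᵥ g)) • a := by
  rw [Matrix.sub_mulVec, Matrix.one_mulVec, Matrix.smul_mulVec, Matrix.vecMulVec_mulVec]
  ext i
  simp only [Pi.sub_apply, Pi.smul_apply, MulOpposite.smul_eq_mul_unop, smul_eq_mul,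
    MulOpposite.unop_op]
  ring

/-- Removing from `g` its component along `a` leaves a vector orthogonal to `a`. -/
theorem star_dotProduct_sub_proj {ι : Type*} [Fintype ι] {a : ι → ℂ} (ha : a ≠ 0) (g : ι → ℂ) :
    star a ⬝ᵥ (g - ((((∑ i, Complex.normSq (a i) : ℝ) : ℂ))⁻¹ * (star a ⬝ᵥ g)) • a) = 0 := by
  have hne : ((∑ i, Complex.normSq (a i) : ℝ) : ℂ) ≠ 0 :=
    Complex.ofReal_ne_zero.mpr (sum_normSq_pos ha).ne'
  rw [dotProduct_sub, dotProduct_smul, star_dotProduct_self_eq_sum_normSq, smul_eq_mul]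
  field_simp
  ring

/-- The number `s / √s` has squared modulus `s`. -/
theorem normSq_inv_sqrt_mul_self {s : ℝ} (hs : 0 < s) :
    Complex.normSq (((Real.sqrt s : ℝ) : ℂ)⁻¹ * (s : ℂ)) = s := by
  rw [map_mul, map_inv₀, Complex.normSq_ofReal, Complex.normSq_ofReal, Real.mul_self_sqrt hs.le]
  field_simp

/-- End-to-end SINR of the FD relay with MRC receive filter `w_r = h/‖h‖` and transmit
zero-forcing beamformer `w_t = Bg/‖Bg‖` (with `a = H* h` and `B = I − a a*/‖a‖²`):
the loopback interference is completely canceled (`w_r* H w_t = 0`) and the SINR of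
Eq. (5) reduces to `(P_S/((1−α)d₁^τ)) ‖h‖² min(1−α, (ηα/d₂^τ) ‖Bg‖²)` (Eq. (16)). -/
theorem sinr_tzf_reduction {MR MT : ℕ} (hMR : 1 ≤ MR) (hMT : 1 ≤ MT)
    (h : Fin MR → ℂ) (hh : h ≠ 0)
    (H : Matrix (Fin MR) (Fin MT) ℂ) (g : Fin MT → ℂ)
    (a : Fin MT → ℂ) (ha_def : a = Hᴴ.mulVec h) (ha : a ≠ 0)
    (B : Matrix (Fin MT) (Fin MT) ℂ)
    (hB : B = (1 : Matrix (Fin MT) (Fin MT) ℂ)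
      - (((∑ i, Complex.normSq (a i) : ℝ) : ℂ))⁻¹ • Matrix.vecMulVec a (star a))
    (hBg : B.mulVec g ≠ 0)
    (wr : Fin MR → ℂ)
    (hwr : wr = ((Real.sqrt (∑ i, Complex.normSq (h i)) : ℝ) : ℂ)⁻¹ • h)
    (wt : Fin MT → ℂ)
    (hwt : wt = ((Real.sqrt (∑ i, Complex.normSq (B.mulVec g i)) : ℝ) : ℂ)⁻¹ • B.mulVec g)
    (PS d1 d2 η α : ℝ) (hPS : 0 < PS) (hd1 : 0 < d1) (hd2 : 0 < d2)
    (hη : 0 < η) (hα0 : 0 < α) (hα1 : α < 1)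
    (κ : ℝ) (hκ : κ = η * α / (1 - α)) :
    star wr ⬝ᵥ H.mulVec wt = 0 ∧
    min (PS * Complex.normSq (star wr ⬝ᵥ h)
          / (κ * PS * (∑ i, Complex.normSq (h i))
              * Complex.normSq (star wr ⬝ᵥ H.mulVec wt) + d1))
        (κ * PS / (d1 * d2) * (∑ i, Complex.normSq (h i))
          * Complex.normSq (star g ⬝ᵥ wt))
      = PS / ((1 - α) * d1) * (∑ i, Complex.normSq (h i))
          * min (1 - α) (η * α / d2 * ∑ i, Complex.normSq (B.mulVec g i)) := by
  have hBg_eq : B.mulVec g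
      = g - ((((∑ i, Complex.normSq (a i) : ℝ) : ℂ))⁻¹ * (star a ⬝ᵥ g)) • a := by
    rw [hB, one_sub_smul_vecMulVec_star_mulVec]
  have horth : star a ⬝ᵥ B.mulVec g = 0 := by
    rw [hBg_eq, star_dotProduct_sub_proj ha]
  have hgBg : star g ⬝ᵥ B.mulVec g
      = ((∑ i, Complex.normSq (B.mulVec g i) : ℝ) : ℂ) := by
    have hstar := congrArg star hBg_eq
    rw [star_sub, star_smul] at hstar
    rw [← star_dotProduct_self_eq_sum_normSq, hstar, sub_dotProduct, smul_dotProduct, horth,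
      smul_zero, sub_zero]
  have hzf : star wr ⬝ᵥ H.mulVec wt = 0 := by
    have hH : star h ⬝ᵥ H.mulVec (B.mulVec g) = 0 := by
      rw [Matrix.dotProduct_mulVec, ← horth, ha_def, Matrix.star_mulVec,
        Matrix.conjTranspose_conjTranspose]
    rw [hwr, hwt, star_smul, smul_dotProduct, Matrix.mulVec_smul, dotProduct_smul, hH,
      smul_zero, smul_zero]
  have hsignal : Complex.normSq (star wr ⬝ᵥ h) = ∑ i, Complex.normSq (h i) := by
    rw [hwr, star_smul, smul_dotProduct, star_dotProduct_self_eq_sum_normSq, smul_eq_mul,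
      star_inv₀, Complex.star_def, Complex.conj_ofReal,
      normSq_inv_sqrt_mul_self (sum_normSq_pos hh)]
  have hforward : Complex.normSq (star g ⬝ᵥ wt) = ∑ i, Complex.normSq (B.mulVec g i) := by
    rw [hwt, dotProduct_smul, hgBg, smul_eq_mul, normSq_inv_sqrt_mul_self (sum_normSq_pos hBg)]
  refine ⟨hzf, ?_⟩
  have hα : 0 < 1 - α := sub_pos.mpr hα1
  have hn := sum_normSq_pos hh
  rw [hzf, hsignal, hforward, map_zero, hκ, mul_min_of_nonneg _ _ (by positivity)]
  congr 1
  · field_simp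
    ring
  · field_simp
end
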